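/- arXiv:1906.00425 — 2 statements merged into one kernel-verified Lean document; each statement's English description precedes it below -/
import Mathlib

section
/- Let d ≥ 2, let μ be the surface measure on the unit sphere S^d ⊂ ℝ^{d+1}, and let f(x) = (1/√m) Σ_{r=1}^m a_r · max(⟨w_r, x⟩, 0) be a two-layer bias-free ReLU network with arbitrary weights w_1,…,w_m ∈ ℝ^{d+1} and a_1,…,a_m ∈ ℝ. Then for every odd integer k ≥ 3 and every polynomial Y : ℝ^{d+1} → ℝ that is homogeneous of degree k and harmonic (its Laplacian is identically zero), ∫_{S^d} f(x) Y(x) dμ(x) = 0. That is, the harmonic expansion of f has zero coefficients at all odd frequencies k ≥ 3. -/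
open MeasureTheory Metric

lemma MvPolynomial.pderiv_comm {ι R : Type*} [CommSemiring R] (i j : ι) (p : MvPolynomial ι R) :
    pderiv i (pderiv j p) = pderiv j (pderiv i p) := by
  classical
  induction p using MvPolynomial.induction_on with
  | C c => simp
  | add p q hp hq => simp only [map_add, hp, hq]
  | mul_X p l hp =>
    simp only [pderiv_mul, map_add, hp, pderiv_X, Pi.single_apply, apply_ite (pderiv _),
      pderiv_one, map_zero, ite_self]
    ring

section GaussianMoments

variable {ι : Type*} [Fintype ι]

lemma integrable_pow_mul_exp_neg_sq_div_two (n : ℕ) :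
    Integrable fun x : ℝ => x ^ n * Real.exp (-x ^ 2 / 2) := by
  have h := integrable_rpow_mul_exp_neg_mul_sq (b := 1 / 2) (by norm_num) (s := n)
    (by have : (0 : ℝ) ≤ n := n.cast_nonneg
        linarith)
  refine h.congr (.of_forall fun x => ?_)
  simp only [Real.rpow_natCast]
  congr 2
  ring

/-- Polynomials are integrable against the standard Gaussian weight. -/
lemma MvPolynomial.integrable_eval_mul_gaussian (p : MvPolynomial ι ℝ) :
    Integrable fun x : EuclideanSpace ℝ ι =>
      MvPolynomial.eval (fun i => x i) p * Real.exp (-‖x‖ ^ 2 / 2) := by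
  induction p using MvPolynomial.induction_on' with
  | monomial s c =>
    rw [← (PiLp.volume_preserving_toLp ι).integrable_comp_emb
      (MeasurableEquiv.toLp 2 (ι → ℝ)).measurableEmbedding]
    refine ((Integrable.fintype_prod fun i =>
      integrable_pow_mul_exp_neg_sq_div_two (s i)).const_mul c).congr (.of_forall fun x => ?_)
    simp only [Function.comp_apply, MvPolynomial.eval_monomial, EuclideanSpace.norm_sq_eq,
      Real.norm_eq_abs, sq_abs, Finset.prod_mul_distrib, ← Real.exp_sum, mul_assoc,
      Finsupp.prod_fintype _ _ fun _ => pow_zero _, ← Finset.sum_neg_distrib, Finset.sum_div]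
  | add p q hp hq =>
    simp only [map_add, add_mul]
    exact hp.add hq

lemma MvPolynomial.hasFDerivAt_eval (p : MvPolynomial ι ℝ) (x : EuclideanSpace ℝ ι) :
    HasFDerivAt (fun y : EuclideanSpace ℝ ι => MvPolynomial.eval (fun i => y i) p)
      (∑ i, MvPolynomial.eval (fun i => x i) (MvPolynomial.pderiv i p) •
        (EuclideanSpace.proj i : EuclideanSpace ℝ ι →L[ℝ] ℝ)) x := by
  classical
  induction p using MvPolynomial.induction_on with
  | C c => simpa using hasFDerivAt_const c x
  | add p q hp hq =>
    simp only [map_add, add_smul, Finset.sum_add_distrib]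
    exact hp.add hq
  | mul_X p j hp =>
    have hj : HasFDerivAt (fun y : EuclideanSpace ℝ ι => y j)
        (EuclideanSpace.proj j : EuclideanSpace ℝ ι →L[ℝ] ℝ) x :=
      (EuclideanSpace.proj j : EuclideanSpace ℝ ι →L[ℝ] ℝ).hasFDerivAt
    simp only [map_mul, MvPolynomial.eval_X]
    refine (hp.mul hj).congr_fderiv ?_
    ext y
    simp [Derivation.leibniz, MvPolynomial.pderiv_X, Pi.single_apply, add_mul,
      Finset.sum_add_distrib, Finset.mul_sum, mul_assoc, apply_ite]

/-- Gaussian integration by parts (Stein's identity) for polynomials. -/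
lemma MvPolynomial.integral_X_mul_gaussian (p : MvPolynomial ι ℝ) (i : ι) :
    ∫ x : EuclideanSpace ℝ ι,
        MvPolynomial.eval (fun i => x i) (MvPolynomial.X i * p) * Real.exp (-‖x‖ ^ 2 / 2) =
      ∫ x : EuclideanSpace ℝ ι,
        MvPolynomial.eval (fun i => x i) (MvPolynomial.pderiv i p) * Real.exp (-‖x‖ ^ 2 / 2) := by
  classical
  set v : EuclideanSpace ℝ ι := EuclideanSpace.single i 1
  have hp (x : EuclideanSpace ℝ ι) :
      fderiv ℝ (fun y : EuclideanSpace ℝ ι => MvPolynomial.eval (fun i => y i) p) x v =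
        MvPolynomial.eval (fun i => x i) (MvPolynomial.pderiv i p) := by
    rw [(p.hasFDerivAt_eval x).fderiv]
    simp [v]
  have hg (x : EuclideanSpace ℝ ι) :
      HasFDerivAt (fun y : EuclideanSpace ℝ ι => Real.exp (-‖y‖ ^ 2 / 2))
        (Real.exp (-‖x‖ ^ 2 / 2) • (-(innerSL ℝ x))) x := by
    have h := ((hasStrictFDerivAt_norm_sq x).hasFDerivAt.const_mul (-1 / 2)).exp
    have heq (y : EuclideanSpace ℝ ι) : -1 / 2 * ‖y‖ ^ 2 = -‖y‖ ^ 2 / 2 := by ring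
    simp only [heq] at h
    refine h.congr_fderiv ?_
    ext y
    simp
    ring
  have hg' (x : EuclideanSpace ℝ ι) :
      fderiv ℝ (fun y : EuclideanSpace ℝ ι => Real.exp (-‖y‖ ^ 2 / 2)) x v =
        - (x i * Real.exp (-‖x‖ ^ 2 / 2)) := by
    rw [(hg x).fderiv]
    simp [v, mul_comm, EuclideanSpace.inner_single_right]
  have hX := (MvPolynomial.X i * p).integrable_eval_mul_gaussian
  have key := integral_mul_fderiv_eq_neg_fderiv_mul_of_integrable (μ := volume)
    (f := fun y : EuclideanSpace ℝ ι => MvPolynomial.eval (fun i => y i) p)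
    (g := fun y : EuclideanSpace ℝ ι => Real.exp (-‖y‖ ^ 2 / 2)) (v := v)
    (by simpa only [hp] using (MvPolynomial.pderiv i p).integrable_eval_mul_gaussian)
    (by
      simp only [hg']
      refine hX.neg.congr (.of_forall fun x => ?_)
      simp
      ring)
    p.integrable_eval_mul_gaussian
    (fun x _ => (p.hasFDerivAt_eval x).differentiableAt)
    (fun x _ => (hg x).differentiableAt)
  simp only [hp, hg', mul_neg, integral_neg, neg_inj] at key
  rw [← key]
  congr 1
  ext x
  simp
  ring

/-- A harmonic homogeneous polynomial of positive degree has Gaussian mean zero. -/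
lemma MvPolynomial.IsHomogeneous.integral_gaussian_eq_zero {p : MvPolynomial ι ℝ} {n : ℕ}
    (hp : p.IsHomogeneous n) (hn : n ≠ 0)
    (hharm : ∑ i, MvPolynomial.pderiv i (MvPolynomial.pderiv i p) = 0) :
    ∫ x : EuclideanSpace ℝ ι,
      MvPolynomial.eval (fun i => x i) p * Real.exp (-‖x‖ ^ 2 / 2) = 0 := by
  have h : (n : ℝ) * ∫ x : EuclideanSpace ℝ ι,
      MvPolynomial.eval (fun i => x i) p * Real.exp (-‖x‖ ^ 2 / 2) = 0 := by
    calc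
      _ = ∫ x : EuclideanSpace ℝ ι, MvPolynomial.eval (fun i => x i)
            (∑ i, MvPolynomial.X i * MvPolynomial.pderiv i p) * Real.exp (-‖x‖ ^ 2 / 2) := by
        rw [hp.sum_X_mul_pderiv, ← integral_const_mul]
        simp [mul_assoc]
      _ = ∑ i, ∫ x : EuclideanSpace ℝ ι, MvPolynomial.eval (fun i => x i)
            (MvPolynomial.X i * MvPolynomial.pderiv i p) * Real.exp (-‖x‖ ^ 2 / 2) := by
        rw [← integral_finsetSum _ fun i _ => integrable_eval_mul_gaussian _]
        simp only [map_sum, Finset.sum_mul]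
      _ = ∫ x : EuclideanSpace ℝ ι, MvPolynomial.eval (fun i => x i)
            (∑ i, MvPolynomial.pderiv i (MvPolynomial.pderiv i p)) *
              Real.exp (-‖x‖ ^ 2 / 2) := by
        simp only [integral_X_mul_gaussian]
        rw [← integral_finsetSum _ fun i _ => integrable_eval_mul_gaussian _]
        simp only [map_sum, Finset.sum_mul]
      _ = 0 := by simp [hharm]
  simpa [hn] using h

/-- Linear forms are Gaussian-orthogonal to harmonic homogeneous polynomials of degree at
least two. -/
lemma MvPolynomial.IsHomogeneous.integral_inner_mul_gaussian_eq_zero {p : MvPolynomial ι ℝ}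
    {n : ℕ} (hp : p.IsHomogeneous n) (hn : 2 ≤ n)
    (hharm : ∑ i, MvPolynomial.pderiv i (MvPolynomial.pderiv i p) = 0)
    (w : EuclideanSpace ℝ ι) :
    ∫ x : EuclideanSpace ℝ ι, inner ℝ w x *
      MvPolynomial.eval (fun i => x i) p * Real.exp (-‖x‖ ^ 2 / 2) = 0 := by
  have hcoord (i : ι) : ∫ x : EuclideanSpace ℝ ι, MvPolynomial.eval (fun i => x i)
      (MvPolynomial.X i * p) * Real.exp (-‖x‖ ^ 2 / 2) = 0 := by
    rw [integral_X_mul_gaussian]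
    refine (hp.pderiv (i := i)).integral_gaussian_eq_zero (by omega) ?_
    have hcomm (j : ι) : pderiv j (pderiv j (pderiv i p)) = pderiv i (pderiv j (pderiv j p)) := by
      rw [pderiv_comm j i, pderiv_comm j i]
    simp only [hcomm, ← map_sum, hharm, map_zero]
  calc
    _ = ∑ i, w i * ∫ x : EuclideanSpace ℝ ι, MvPolynomial.eval (fun i => x i)
          (MvPolynomial.X i * p) * Real.exp (-‖x‖ ^ 2 / 2) := by
      simp only [← integral_const_mul]
      rw [← integral_finsetSum _ fun i _ => (integrable_eval_mul_gaussian _).const_mul _]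
      refine integral_congr_ae (.of_forall fun x => ?_)
      simp only [PiLp.inner_apply, Finset.sum_mul, map_mul, eval_X]
      refine Finset.sum_congr rfl fun i _ => ?_
      simp
      ring
    _ = 0 := by simp only [hcoord, mul_zero, Finset.sum_const_zero]

end GaussianMoments

lemma MvPolynomial.IsHomogeneous.eval_smul {ι R : Type*} [CommSemiring R]
    {p : MvPolynomial ι R} {n : ℕ} (hp : p.IsHomogeneous n) (r : R) (x : ι → R) :
    MvPolynomial.eval (fun i => r * x i) p = r ^ n * MvPolynomial.eval x p := by
  simp only [eval_eq, mul_pow, Finset.prod_mul_distrib, Finset.prod_pow_eq_pow_sum, Finset.mul_sum]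
  refine Finset.sum_congr rfl fun s hs => ?_
  rw [hp.degree_eq_sum_deg_support hs]
  ring

/-- If a positively homogeneous function has vanishing Gaussian integral, then its integral over
the unit sphere vanishes. -/
lemma integral_toSphere_eq_zero_of_integral_gaussian_eq_zero {E : Type*}
    [NormedAddCommGroup E] [NormedSpace ℝ E] [FiniteDimensional ℝ E] [Nontrivial E]
    [MeasurableSpace E] [BorelSpace E] (μ : Measure E) [μ.IsAddHaarMeasure] {g : E → ℝ} {n : ℕ}
    (hg : ∀ r : ℝ, 0 < r → ∀ x, g (r • x) = r ^ n * g x)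
    (h : ∫ x, g x * Real.exp (-‖x‖ ^ 2 / 2) ∂μ = 0) :
    ∫ x : sphere (0 : E) 1, g x ∂μ.toSphere = 0 := by
  set N := Module.finrank ℝ E - 1
  have hpolar : ∫ x, g x * Real.exp (-‖x‖ ^ 2 / 2) ∂μ = (∫ x : sphere (0 : E) 1, g x ∂μ.toSphere) *
      ∫ r : Set.Ioi (0 : ℝ), (r : ℝ) ^ n * Real.exp (-(r : ℝ) ^ 2 / 2) ∂.volumeIoiPow N := by
    rw [← integral_prod_mul, ← (μ.measurePreserving_homeomorphUnitSphereProd).integral_comp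
      (Homeomorph.measurableEmbedding _), ← restrict_compl_singleton (μ := μ) 0,
      ← integral_subtype_comap (measurableSet_singleton _).compl
        fun x => g x * Real.exp (-‖x‖ ^ 2 / 2)]
    simp only [restrict_compl_singleton]
    refine integral_congr_ae (.of_forall fun x => ?_)
    have hx : 0 < ‖(x : E)‖ := norm_pos_iff.2 x.2
    have := hg _ hx (‖(x : E)‖⁻¹ • (x : E))
    rw [smul_inv_smul₀ hx.ne'] at this
    simp [this]
    ring
  have hrad : 0 < ∫ r : Set.Ioi (0 : ℝ),
      (r : ℝ) ^ n * Real.exp (-(r : ℝ) ^ 2 / 2) ∂.volumeIoiPow N := by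
    simp only [Measure.volumeIoiPow, ENNReal.ofReal]
    rw [integral_withDensity_eq_integral_smul
      (measurable_subtype_coe.pow_const _).real_toNNReal,
      integral_subtype_comap measurableSet_Ioi fun r : ℝ =>
        Real.toNNReal (r ^ N) • (r ^ n * Real.exp (-r ^ 2 / 2)),
      setIntegral_congr_fun (g := fun r : ℝ => r ^ ((N + n : ℕ) : ℝ) *
        Real.exp (-(1 / 2) * r ^ (2 : ℝ))) measurableSet_Ioi fun r hr => ?_]
    · rw [integral_rpow_mul_exp_neg_mul_rpow (by norm_num)
        (by have : (0 : ℝ) ≤ (N + n : ℕ) := Nat.cast_nonneg _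
            linarith) (by norm_num)]
      have : 0 < Real.Gamma ((((N + n : ℕ) : ℝ) + 1) / 2) := Real.Gamma_pos_of_pos (by positivity)
      positivity
    · simp only [NNReal.smul_def, Real.coe_toNNReal _ (pow_nonneg (le_of_lt hr) _), smul_eq_mul,
        Real.rpow_natCast, Real.rpow_two, pow_add]
      rw [← mul_assoc]
      congr 2
      ring
  rw [hpolar] at h
  exact (mul_eq_zero.1 h).resolve_right hrad.ne'

/-- A single ReLU neuron is orthogonal on the sphere to every harmonic homogeneous polynomial of
odd degree at least three. -/
lemma integral_relu_mul_harmonic_toSphere_eq_zero {ι : Type*} [Fintype ι] [Nonempty ι]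
    {k : ℕ} (hko : Odd k) (hk : 3 ≤ k) {Y : MvPolynomial ι ℝ} (hY : Y.IsHomogeneous k)
    (hharm : ∑ i, MvPolynomial.pderiv i (MvPolynomial.pderiv i Y) = 0)
    (w : EuclideanSpace ℝ ι) :
    ∫ x : sphere (0 : EuclideanSpace ℝ ι) 1,
      max (inner ℝ w (x : EuclideanSpace ℝ ι)) 0 *
        MvPolynomial.eval (fun i => (x : EuclideanSpace ℝ ι) i) Y
      ∂(volume : Measure (EuclideanSpace ℝ ι)).toSphere = 0 := by
  refine integral_toSphere_eq_zero_of_integral_gaussian_eq_zero (n := k + 1) volume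
    (g := fun x => max (inner ℝ w x) 0 * MvPolynomial.eval (fun i => x i) Y)
    (fun r hr x => ?_) ?_
  · have h1 : max (inner ℝ w (r • x)) 0 = r * max (inner ℝ w x) 0 := by
      rw [real_inner_smul_right, mul_max_of_nonneg _ _ hr.le, mul_zero]
    have h2 := hY.eval_smul r (fun i => x i)
    simp only [PiLp.smul_apply, smul_eq_mul, h1, h2]
    ring
  set F : EuclideanSpace ℝ ι → ℝ := fun x =>
    max (inner ℝ w x) 0 * MvPolynomial.eval (fun i => x i) Y * Real.exp (-‖x‖ ^ 2 / 2) with hF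
  have hYcont : Continuous fun x : EuclideanSpace ℝ ι => MvPolynomial.eval (fun i => x i) Y :=
    continuous_iff_continuousAt.2 fun x => (Y.hasFDerivAt_eval x).continuousAt
  have hint : Integrable F := by
    have hlin : Integrable fun x : EuclideanSpace ℝ ι =>
        inner ℝ w x * MvPolynomial.eval (fun i => x i) Y * Real.exp (-‖x‖ ^ 2 / 2) := by
      refine (integrable_finsetSum Finset.univ fun i _ =>
        ((MvPolynomial.X i * Y).integrable_eval_mul_gaussian).const_mul (w i)).congr
          (.of_forall fun x => ?_)
      simp only [PiLp.inner_apply, Finset.sum_mul, map_mul, MvPolynomial.eval_X]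
      refine Finset.sum_congr rfl fun i _ => ?_
      simp
      ring
    refine hlin.mono (by fun_prop) (.of_forall fun x => ?_)
    simp only [hF, norm_mul]
    gcongr
    rw [Real.norm_eq_abs, Real.norm_eq_abs, abs_of_nonneg (le_max_right _ _)]
    exact max_le (le_abs_self _) (abs_nonneg _)
  have hsum : (∫ x, F x) + ∫ x, F x = 0 := by
    nth_rw 2 [← integral_neg_eq_self]
    rw [← integral_add hint hint.comp_neg,
      ← hY.integral_inner_mul_gaussian_eq_zero (by omega) hharm w]
    refine integral_congr_ae (.of_forall fun x => ?_)
    have h2 := hY.eval_smul (-1) (fun i => x i)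
    simp only [neg_mul, one_mul, hko.neg_one_pow] at h2
    have h3 : max (inner ℝ w x) 0 - max (-inner ℝ w x) 0 = inner ℝ w x := by
      have := max_zero_sub_eq_self (inner ℝ w x)
      linarith
    simp only [hF, PiLp.neg_apply, inner_neg_right, norm_neg, h2]
    conv_rhs => rw [← h3]
    ring
  change ∫ x, F x = 0
  linarith

/-- A two-layer bias-free ReLU network on `S^d` (`d ≥ 2`) has vanishing harmonic
coefficients at every odd frequency `k ≥ 3`: its integral against any spherical
harmonic of odd degree `k ≥ 3` (the restriction to the sphere of a homogeneous
harmonic polynomial of degree `k`) is zero. -/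
theorem two_layer_bias_free_no_odd_frequencies (d : ℕ) (hd : 2 ≤ d) (m : ℕ) (hm : 1 ≤ m)
    (a : Fin m → ℝ) (w : Fin m → EuclideanSpace ℝ (Fin (d + 1)))
    (k : ℕ) (hko : Odd k) (hk : 3 ≤ k)
    (Y : MvPolynomial (Fin (d + 1)) ℝ)
    (hY : Y.IsHomogeneous k)
    (hharm : ∑ i, MvPolynomial.pderiv i (MvPolynomial.pderiv i Y) = 0) :
    (∫ x : sphere (0 : EuclideanSpace ℝ (Fin (d + 1))) 1,
        ((1 / Real.sqrt m) * ∑ r, a r *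
            max (inner (𝕜 := ℝ) (w r) (x : EuclideanSpace ℝ (Fin (d + 1)))) 0)
          * MvPolynomial.eval (fun i => (x : EuclideanSpace ℝ (Fin (d + 1))) i) Y
        ∂((volume : Measure (EuclideanSpace ℝ (Fin (d + 1)))).toSphere)) = 0 := by
  have hYcont : Continuous fun x : EuclideanSpace ℝ (Fin (d + 1)) =>
      MvPolynomial.eval (fun i => x i) Y :=
    continuous_iff_continuousAt.2 fun x => (Y.hasFDerivAt_eval x).continuousAt
  have hint (r : Fin m) : Integrable (fun x : sphere (0 : EuclideanSpace ℝ (Fin (d + 1))) 1 =>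
      a r * (max (inner ℝ (w r) (x : EuclideanSpace ℝ (Fin (d + 1)))) 0 *
        MvPolynomial.eval (fun i => (x : EuclideanSpace ℝ (Fin (d + 1))) i) Y))
      (volume : Measure (EuclideanSpace ℝ (Fin (d + 1)))).toSphere := by
    have hc : Continuous fun x : EuclideanSpace ℝ (Fin (d + 1)) =>
        a r * (max (inner ℝ (w r) x) 0 * MvPolynomial.eval (fun i => x i) Y) := by fun_prop
    exact (hc.comp continuous_subtype_val).integrable_of_hasCompactSupport
      (.of_compactSpace _)
  simp only [mul_assoc, Finset.sum_mul]
  rw [integral_const_mul, integral_finsetSum _ fun r _ => hint r]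
  simp only [integral_const_mul, integral_relu_mul_harmonic_toSphere_eq_zero hko hk hY hharm,
    mul_zero, Finset.sum_const_zero]
end

section
/- Let d ≥ 2 be an even integer, let k ≥ 3 be an odd integer, and set p = k + (d−2)/2. Then ∫_{−1}^{1} (1/(4π)) (t + 1)(π − arccos t) · (d^k/dt^k)[(1 − t²)^p] dt = (1/2) Σ_{q = ⌈k/2⌉}^{p} C2(q,d,k) · (1/(2(2q − k + 1))) · (1 − (1/2^{2q−k+1}) · binom(2q − k + 1, (2q − k + 1)/2)), where C2(q,d,k) = (−1)^q binom(p, q) (2q)!/(2q − k)!. Consequently the eigenvalue c_k^d of convolution with the bias-adjusted kernel K̄∞ on S^d at odd frequency k ≥ 3 equals (1/2) C1(d,k) times twice this expression, and in particular is nonzero. -/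
open Real Polynomial


theorem iteratedDeriv_polynomial_eval (P : ℝ[X]) (n : ℕ) :
    iteratedDeriv n (fun x => P.eval x) = fun x => (derivative^[n] P).eval x := by
  induction n with
  | zero => simp
  | succ n ih =>
    rw [iteratedDeriv_succ, ih, Function.iterate_succ_apply']
    ext x
    exact Polynomial.deriv _

theorem eval_iterate_derivative_one_sub_sq_pow {m p : ℕ} (h : m < p) {a : ℝ} (ha : a ^ 2 = 1) :
    (derivative^[m] ((1 - X ^ 2 : ℝ[X]) ^ p)).eval a = 0 := by
  have hdvd : (X - C a) ^ p ∣ (1 - X ^ 2 : ℝ[X]) ^ p := by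
    refine pow_dvd_pow_of_dvd (dvd_iff_isRoot.mpr ?_) p
    simp [ha]
  have := pow_sub_dvd_iterate_derivative_of_pow_dvd m hdvd
  exact dvd_iff_isRoot.mp ((dvd_pow_self _ (by omega)).trans this)

/-- Substituting `t = sin θ` and integrating by parts. -/
theorem integral_arcsin_mul_derivative_eval (Q : ℝ[X]) :
    ∫ t in (-1 : ℝ)..1, arcsin t * (derivative Q).eval t
      = π / 2 * (Q.eval 1 + Q.eval (-1)) - ∫ θ in (-(π / 2))..(π / 2), Q.eval (sin θ) := by
  have hsub := intervalIntegral.integral_comp_mul_deriv (a := -(π / 2)) (b := π / 2)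
    (f := sin) (f' := cos) (g := fun t => arcsin t * (derivative Q).eval t)
    (fun x _ => hasDerivAt_sin x) continuous_cos.continuousOn
    (continuous_arcsin.mul (derivative Q).continuous)
  have hparts := intervalIntegral.integral_mul_deriv_eq_deriv_mul (a := -(π / 2)) (b := π / 2)
    (u := fun θ => θ) (u' := fun _ => 1) (v := fun θ => Q.eval (sin θ))
    (v' := fun θ => (derivative Q).eval (sin θ) * cos θ)
    (fun x _ => hasDerivAt_id x)
    (fun x _ => (Q.hasDerivAt (sin x)).comp x (hasDerivAt_sin x))
    intervalIntegrable_const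
    (by apply Continuous.intervalIntegrable; fun_prop)
  rw [sin_neg, sin_pi_div_two] at hsub
  rw [← hsub]
  simp only [sin_neg, sin_pi_div_two, one_mul] at hparts
  rw [show π / 2 * (Q.eval 1 + Q.eval (-1)) = π / 2 * Q.eval 1 - -(π / 2) * Q.eval (-1) by ring,
    ← hparts]
  refine intervalIntegral.integral_congr fun θ hθ => ?_
  rw [Set.uIcc_of_le (by linarith [pi_pos])] at hθ
  simp only [Function.comp, arcsin_sin hθ.1 hθ.2]
  ring

theorem integral_sin_pow_even_symm (n : ℕ) :
    ∫ θ in (-(π / 2))..(π / 2), sin θ ^ (2 * n) = π * (n.centralBinom / 2 ^ (2 * n)) := by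
  induction n with
  | zero => simp
  | succ n ih =>
    rw [Nat.mul_succ, integral_sin_pow, ih]
    have h : ((n : ℝ) + 1) * (n + 1).centralBinom = 2 * (2 * n + 1) * n.centralBinom := by
      exact_mod_cast n.succ_mul_centralBinom_succ
    have h' : ((n + 1).centralBinom : ℝ) = 2 * (2 * n + 1) * n.centralBinom / (n + 1) := by
      rw [← h]; field_simp
    rw [h']
    simp only [cos_neg, cos_pi_div_two]
    push_cast
    field_simp
    ring

theorem integral_arcsin_mul_pow {n r : ℕ} (h : n + 1 = 2 * r) :
    ∫ t in (-1 : ℝ)..1, arcsin t * t ^ n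
      = π * (1 / ((n + 1 : ℕ) : ℝ) * (1 - 1 / 2 ^ (n + 1) * (n + 1).choose ((n + 1) / 2))) := by
  have hn : ((n : ℝ) + 1) ≠ 0 := by positivity
  have key := integral_arcsin_mul_derivative_eval (C ((n + 1 : ℝ)⁻¹) * X ^ (n + 1))
  have hev : (-1 : ℝ) ^ (n + 1) = 1 := by rw [h]; simp
  simp only [derivative_C_mul, derivative_X_pow, eval_mul, eval_C, eval_pow, eval_X, one_pow, hev,
    intervalIntegral.integral_const_mul, Nat.add_sub_cancel, Nat.cast_add, Nat.cast_one,
    inv_mul_cancel_left₀ hn] at key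
  rw [key, h, integral_sin_pow_even_symm, Nat.mul_div_cancel_left r two_pos,
    Nat.centralBinom_eq_two_mul_choose, ← h]
  push_cast
  field_simp
  ring

/-- The integral of `(d/dt)^m (1 - t²)^p` against `(1 - t²)^(-1/2) dt` on `[-1, 1]`. -/
noncomputable def chebyshevMoment (m p : ℕ) : ℝ :=
  ∫ θ in (-(π / 2))..(π / 2), (derivative^[m] ((1 - X ^ 2 : ℝ[X]) ^ p)).eval (sin θ)

theorem chebyshevMoment_add_two (m p : ℕ) :
    chebyshevMoment (m + 2) (p + 2)
      = (2 * p + 4) * (2 * p + 2) * chebyshevMoment m p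
        - (2 * p + 4) * (2 * p + 3) * chebyshevMoment m (p + 1) := by
  have hpoly : derivative^[m + 2] ((1 - X ^ 2 : ℝ[X]) ^ (p + 2))
      = C ((2 * p + 4) * (2 * p + 2) : ℝ) * derivative^[m] ((1 - X ^ 2) ^ p)
        - C ((2 * p + 4) * (2 * p + 3) : ℝ) * derivative^[m] ((1 - X ^ 2) ^ (p + 1)) := by
    rw [Function.iterate_add_apply, ← iterate_derivative_C_mul, ← iterate_derivative_C_mul,
      ← iterate_derivative_sub]
    congr 1
    simp only [Function.iterate_succ_apply, Function.iterate_zero, id, derivative_pow,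
      derivative_mul, derivative_sub, derivative_one, derivative_X, map_mul, map_add,
      map_natCast, map_ofNat, Nat.add_sub_cancel, show p + 2 - 1 = p + 1 by omega]
    push_cast
    simp
    ring
  simp only [chebyshevMoment]
  rw [hpoly]
  simp only [eval_sub, eval_mul, eval_C]
  rw [intervalIntegral.integral_sub, intervalIntegral.integral_const_mul,
    intervalIntegral.integral_const_mul]
  all_goals apply Continuous.intervalIntegrable; fun_prop

theorem chebyshevMoment_zero_succ (p : ℕ) :
    (2 * p + 2) * chebyshevMoment 0 (p + 1) = (2 * p + 1) * chebyshevMoment 0 p := by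
  have h (p : ℕ) : chebyshevMoment 0 p = ∫ θ in (-(π / 2))..(π / 2), cos θ ^ (2 * p) := by
    refine intervalIntegral.integral_congr fun θ _ => ?_
    simp [pow_mul, cos_sq']
  rw [h, h, Nat.mul_succ, integral_cos_pow]
  simp only [cos_neg, cos_pi_div_two]
  push_cast
  field_simp
  ring

theorem chebyshevMoment_zero_pos (p : ℕ) : 0 < chebyshevMoment 0 p := by
  induction p with
  | zero => simp [chebyshevMoment, pi_pos]
  | succ p ih =>
    have := chebyshevMoment_zero_succ p
    have h2 : 0 < (2 * (p : ℝ) + 1) * chebyshevMoment 0 p := by positivity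
    rw [← this] at h2
    exact pos_of_mul_pos_right h2 (by positivity)

theorem chebyshevMoment_even (j : ℕ) : ∀ r : ℕ,
    0 < chebyshevMoment (2 * j) (2 * j + r) ∧
    (2 * j + 2 * r + 2 : ℝ) ^ 2 * chebyshevMoment (2 * j) (2 * j + r + 1)
      = (4 * j + 2 * r + 2) * (2 * r + 1) * chebyshevMoment (2 * j) (2 * j + r) := by
  induction j with
  | zero =>
    intro r
    refine ⟨by simpa using chebyshevMoment_zero_pos r, ?_⟩
    have := chebyshevMoment_zero_succ r
    simp only [Nat.mul_zero, Nat.zero_add, Nat.cast_zero]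
    linear_combination (2 * r + 2 : ℝ) * this
  | succ j ih =>
    have step (r : ℕ) : (2 * j + 2 * r + 2 : ℝ) ^ 2
        * chebyshevMoment (2 * (j + 1)) (2 * (j + 1) + r)
        = (4 * j + 2 * r + 4) * (4 * j + 2 * r + 2) * (2 * j + 1) ^ 2
          * chebyshevMoment (2 * j) (2 * j + r) := by
      have h := chebyshevMoment_add_two (2 * j) (2 * j + r)
      rw [show 2 * (j + 1) + r = 2 * j + r + 2 by ring, show 2 * (j + 1) = 2 * j + 2 by ring, h]
      push_cast
      linear_combination (-(4 * j + 2 * r + 4) * (4 * j + 2 * r + 3) : ℝ) * (ih r).2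
    intro r
    constructor
    · have h := step r
      have hpos := (ih r).1
      have h2 : 0 < (4 * j + 2 * r + 4 : ℝ) * (4 * j + 2 * r + 2) * (2 * j + 1) ^ 2
          * chebyshevMoment (2 * j) (2 * j + r) := by positivity
      rw [← h] at h2
      exact pos_of_mul_pos_right h2 (by positivity)
    · have h0 := step r
      have h1 := step (r + 1)
      have hr := (ih r).2
      have hne : (2 * j + 2 * r + 2 : ℝ) ^ 2 ≠ 0 := by positivity
      refine mul_left_cancel₀ hne ?_
      simp only [← add_assoc] at h1
      push_cast at h1 ⊢
      linear_combination (2 * j + 2 * r + 2 : ℝ) ^ 2 * h1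
        + (4 * j + 2 * r + 6 : ℝ) * (4 * j + 2 * r + 4) * (2 * j + 1) ^ 2 * hr
        - (4 * j + 2 * r + 6 : ℝ) * (2 * r + 1) * h0

theorem iterate_derivative_one_sub_sq_pow (k p : ℕ) :
    derivative^[k] ((1 - X ^ 2 : ℝ[X]) ^ p)
      = ∑ q ∈ Finset.Icc ((k + 1) / 2) p,
        C ((-1 : ℝ) ^ q * p.choose q * ((2 * q).factorial / (2 * q - k).factorial))
          * X ^ (2 * q - k) := by
  have hexp : (1 - X ^ 2 : ℝ[X]) ^ p
      = ∑ q ∈ Finset.range (p + 1), C ((-1 : ℝ) ^ q * p.choose q) * X ^ (2 * q) := by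
    rw [sub_eq_neg_add, add_pow]
    refine Finset.sum_congr rfl fun q _ => ?_
    rw [neg_pow, pow_mul]
    simp
    ring
  rw [hexp, iterate_derivative_sum]
  symm
  refine Finset.sum_subset_zero_on_sdiff (fun q hq => ?_) (fun q hq => ?_) (fun q hq => ?_)
  · simp only [Finset.mem_Icc, Finset.mem_range] at hq ⊢
    omega
  · simp only [Finset.mem_sdiff, Finset.mem_Icc, Finset.mem_range] at hq
    rw [iterate_derivative_C_mul, iterate_derivative_X_pow_eq_natCast_mul,
      Nat.descFactorial_of_lt (by omega)]
    simp
  · simp only [Finset.mem_Icc] at hq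
    have hle : k ≤ 2 * q := by omega
    rw [iterate_derivative_C_mul, iterate_derivative_X_pow_eq_natCast_mul, ← mul_assoc]
    congr 1
    rw [← map_natCast C, ← C_mul, ← Nat.factorial_mul_descFactorial hle, Nat.cast_mul,
      mul_div_cancel_left₀ _ (by positivity)]

theorem intervalIntegral_eq_zero_of_odd {f : ℝ → ℝ} (hf : ∀ t, f (-t) = -f t) (a : ℝ) :
    ∫ t in (-a)..a, f t = 0 := by
  have h := intervalIntegral.integral_comp_neg (a := -a) (b := a) f
  simp only [hf, intervalIntegral.integral_neg, neg_neg] at h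
  linarith

theorem integral_mul_iterate_derivative_eq_zero {k p : ℕ} (hk : 2 ≤ k) (hp : k ≤ p) :
    ∫ t in (-1 : ℝ)..1, t * (derivative^[k] ((1 - X ^ 2 : ℝ[X]) ^ p)).eval t = 0 := by
  obtain ⟨m, rfl⟩ := Nat.exists_eq_add_of_le' hk
  set g := derivative^[m] ((1 - X ^ 2 : ℝ[X]) ^ p) with hg
  have h0 {a : ℝ} (ha : a ^ 2 = 1) : g.eval a = 0 :=
    eval_iterate_derivative_one_sub_sq_pow (by omega) ha
  have h1 {a : ℝ} (ha : a ^ 2 = 1) : (derivative g).eval a = 0 := by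
    rw [hg, ← Function.iterate_succ_apply' derivative]
    exact eval_iterate_derivative_one_sub_sq_pow (by omega) ha
  have h2 : derivative^[m + 2] ((1 - X ^ 2 : ℝ[X]) ^ p) = derivative (derivative g) := by
    rw [hg, ← Function.iterate_succ_apply' derivative, ← Function.iterate_succ_apply' derivative]
  have hd : derivative (X * derivative g - g) = X * derivative (derivative g) := by
    simp [derivative_mul]
  have := intervalIntegral.integral_eq_sub_of_hasDerivAt (a := -1) (b := 1)
    (fun x _ => (X * derivative g - g).hasDerivAt x)
    ((derivative (X * derivative g - g)).continuous.intervalIntegrable _ _)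
  rw [hd] at this
  simpa [h2, h0, h1] using this

/-- Only the odd part `t π / 2 + arcsin t` of `(t + 1) (π - arccos t)` contributes, and its
linear term is annihilated. -/
theorem integral_biasAdjusted_eq {k p : ℕ} (hk : 2 ≤ k) (hko : Odd k) (hp : k ≤ p) :
    ∫ t in (-1 : ℝ)..1, (1 / (4 * π)) * (t + 1) * (π - arccos t)
        * iteratedDeriv k (fun s : ℝ => (1 - s ^ 2) ^ p) t
      = 1 / (4 * π) * ∫ t in (-1 : ℝ)..1,
          arcsin t * (derivative^[k] ((1 - X ^ 2 : ℝ[X]) ^ p)).eval t := by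
  have hfun : (fun s : ℝ => (1 - s ^ 2) ^ p) = fun s => ((1 - X ^ 2 : ℝ[X]) ^ p).eval s := by
    simp
  have hodd (t : ℝ) : (derivative^[k] ((1 - X ^ 2 : ℝ[X]) ^ p)).eval (-t)
      = -(derivative^[k] ((1 - X ^ 2 : ℝ[X]) ^ p)).eval t := by
    rw [iterate_derivative_one_sub_sq_pow, eval_finsetSum, eval_finsetSum,
      ← Finset.sum_neg_distrib]
    refine Finset.sum_congr rfl fun q hq => ?_
    have : Odd (2 * q - k) := by
      simp only [Finset.mem_Icc] at hq
      obtain ⟨r, rfl⟩ := hko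
      exact ⟨q - r - 1, by omega⟩
    simp [this.neg_pow]
  rw [hfun, iteratedDeriv_polynomial_eval]
  set H := derivative^[k] ((1 - X ^ 2 : ℝ[X]) ^ p) with hH
  have hlin : ∫ t in (-1 : ℝ)..1, t * H.eval t = 0 :=
    integral_mul_iterate_derivative_eq_zero hk hp
  have hzero : ∫ t in (-1 : ℝ)..1, (π / 2 + t * arcsin t) * H.eval t = 0 :=
    intervalIntegral_eq_zero_of_odd (fun t => by rw [hodd, arcsin_neg]; ring) 1
  have hcont := continuous_arcsin
  have hsplit : ∀ t : ℝ, (1 / (4 * π)) * (t + 1) * (π - arccos t) * H.eval t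
      = 1 / (4 * π) * (arcsin t * H.eval t + (π / 2 * (t * H.eval t)
        + (π / 2 + t * arcsin t) * H.eval t)) := fun t => by
    rw [arccos]; ring
  simp only [hsplit]
  rw [intervalIntegral.integral_const_mul, intervalIntegral.integral_add,
    intervalIntegral.integral_add, intervalIntegral.integral_const_mul, hlin, hzero]
  · simp
  all_goals apply Continuous.intervalIntegrable; fun_prop

/-- For even `d ≥ 2` and odd `k ≥ 3`, with `p = k + (d−2)/2`:
`∫_{−1}^{1} K̄∞(t) (d^k/dt^k)[(1−t²)^p] dt
  = (1/2) Σ_{q=⌈k/2⌉}^{p} C2(q,d,k) (1/(2(2q−k+1))) (1 − 2^{−(2q−k+1)} C(2q−k+1,(2q−k+1)/2))`,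
where `K̄∞(t) = (1/(4π))(t+1)(π − arccos t)` and `C2(q,d,k) = (−1)^q C(p,q) (2q)!/(2q−k)!`;
in particular this integral (hence the eigenvalue at odd frequency `k`) is nonzero. -/
theorem eigenvalue_bias_adjusted_odd (d k : ℕ) (hd : 2 ≤ d) (hde : Even d)
    (hk : 3 ≤ k) (hko : Odd k) :
    (∫ t in (-1:ℝ)..1,
        (1 / (4 * π)) * (t + 1) * (π - Real.arccos t)
          * iteratedDeriv k (fun s : ℝ => (1 - s ^ 2) ^ (k + (d - 2) / 2)) t)
      = (1 / 2) * ∑ q ∈ Finset.Icc ((k + 1) / 2) (k + (d - 2) / 2),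
          ((-1 : ℝ) ^ q * (Nat.choose (k + (d - 2) / 2) q : ℝ)
              * (((2 * q).factorial : ℝ) / ((2 * q - k).factorial : ℝ)))
            * (1 / (2 * ((2 * q - k + 1 : ℕ) : ℝ)))
            * (1 - (1 : ℝ) / 2 ^ (2 * q - k + 1)
                * (Nat.choose (2 * q - k + 1) ((2 * q - k + 1) / 2) : ℝ)) ∧
    (∫ t in (-1:ℝ)..1,
        (1 / (4 * π)) * (t + 1) * (π - Real.arccos t)
          * iteratedDeriv k (fun s : ℝ => (1 - s ^ 2) ^ (k + (d - 2) / 2)) t) ≠ 0 := by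
  have hp : k ≤ k + (d - 2) / 2 := Nat.le_add_right _ _
  generalize k + (d - 2) / 2 = p at hp ⊢
  rw [integral_biasAdjusted_eq (by omega) hko hp]
  constructor
  · rw [iterate_derivative_one_sub_sq_pow]
    simp only [eval_finsetSum, Finset.mul_sum]
    rw [intervalIntegral.integral_finsetSum, Finset.mul_sum]
    · refine Finset.sum_congr rfl fun q hq => ?_
      obtain ⟨r, rfl⟩ := hko
      simp only [Finset.mem_Icc] at hq
      have hr : 2 * q - (2 * r + 1) + 1 = 2 * (q - r) := by omega
      simp only [eval_mul, eval_C, eval_pow, eval_X, mul_left_comm (arcsin _),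
        intervalIntegral.integral_const_mul]
      rw [integral_arcsin_mul_pow hr]
      have : ((2 * q - (2 * r + 1) + 1 : ℕ) : ℝ) ≠ 0 := by positivity
      field_simp
      ring
    · intro q _
      have hcont := continuous_arcsin
      apply Continuous.intervalIntegrable
      fun_prop
  · obtain ⟨j, rfl⟩ := hko
    obtain ⟨r, rfl⟩ := Nat.exists_eq_add_of_le hp
    have hpos := (chebyshevMoment_even j (r + 1)).1
    have hsucc : derivative^[2 * j + 1] ((1 - X ^ 2 : ℝ[X]) ^ (2 * j + 1 + r))
        = derivative (derivative^[2 * j] ((1 - X ^ 2) ^ (2 * j + 1 + r))) :=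
      Function.iterate_succ_apply' _ _ _
    rw [hsucc, integral_arcsin_mul_derivative_eval,
      eval_iterate_derivative_one_sub_sq_pow (by omega) (by norm_num),
      eval_iterate_derivative_one_sub_sq_pow (by omega) (by norm_num)]
    rw [chebyshevMoment, show 2 * j + (r + 1) = 2 * j + 1 + r by ring] at hpos
    refine mul_ne_zero (by positivity) (ne_of_lt ?_)
    linarith
end
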